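/- arXiv:1311.2298 — 2 statements merged into one kernel-verified Lean document; each statement's English description precedes it below -/
import Mathlib

section
/- Suppose that 𝒜 ⊆ 𝒫(n) is a counterexample to the union-closed conjecture, let ℬ = 𝒫(n) ∖ 𝒜 with |ℬ| = m, and let p ∈ [0,1]. If |ℬ_{{i}}| ≥ 3p·m for some i ∈ [n], then ‖I(m)‖ > m(n/2 − 1 + p). -/
open Finset
open scoped Classical

/-- The total size `‖𝒜‖ = Σ_{A∈𝒜} |A|` of a family of finite sets. -/
def totalSize (𝒜 : Finset (Finset ℕ)) : ℕ := ∑ A ∈ 𝒜, A.card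

/-- A family is union-closed if it is closed under pairwise unions. -/
def UnionClosed (𝒜 : Finset (Finset ℕ)) : Prop := ∀ A ∈ 𝒜, ∀ B ∈ 𝒜, A ∪ B ∈ 𝒜

/-- The `k`-th finite set of positive integers in the colex order: the positive
integer `i` belongs to it iff bit `i - 1` of `k` is set. -/
def colexSet (k : ℕ) : Finset ℕ :=
  ((Finset.range (k + 1)).filter fun i => k.testBit i).image (· + 1)

/-- The initial segment `I(m)` of length `m` of the colex order on finite sets
of positive integers. -/
def colexInit (m : ℕ) : Finset (Finset ℕ) := (Finset.range m).image colexSet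

/-- A family `ℬ` is simply rooted if every nonempty `B ∈ ℬ` has some `b ∈ B`
with the whole cube `[{b}, B]` contained in `ℬ`. -/
def SimplyRooted (ℬ : Finset (Finset ℕ)) : Prop :=
  ∀ B ∈ ℬ, B.Nonempty → ∃ b ∈ B, ∀ C : Finset ℕ, {b} ⊆ C → C ⊆ B → C ∈ ℬ

/-- `B` is `ℬ`-rooted at `i`: `i ∈ B` and the cube `[{i}, B]` lies in `ℬ`. -/
def RootedAt (ℬ : Finset (Finset ℕ)) (B : Finset ℕ) (i : ℕ) : Prop :=
  i ∈ B ∧ ∀ C : Finset ℕ, {i} ⊆ C → C ⊆ B → C ∈ ℬ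

/-- `ℬ_S`: the sets of `ℬ` that are `ℬ`-rooted at some element of `S`. -/
noncomputable def rootedFam (ℬ : Finset (Finset ℕ)) (S : Finset ℕ) : Finset (Finset ℕ) :=
  ℬ.filter fun B => ∃ i ∈ S, RootedAt ℬ B i

/-- The image of a single set `B` under the down-compression of `ℬ` in
direction `i`. -/
def compressSet (ℬ : Finset (Finset ℕ)) (i : ℕ) (B : Finset ℕ) : Finset ℕ :=
  if i ∈ B ∧ B.erase i ∉ ℬ then B.erase i else B

/-- The down-compression `d_i(ℬ)` of the family `ℬ` in direction `i`. -/
def dComp (i : ℕ) (ℬ : Finset (Finset ℕ)) : Finset (Finset ℕ) :=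
  ℬ.image (compressSet ℬ i)

/-- `D_k(ℬ) = d_k(⋯ d_1(ℬ) ⋯)`.  In particular `d(ℬ) = D_n(ℬ)` for
`ℬ ⊆ 𝒫(n)`. -/
def DComp : ℕ → Finset (Finset ℕ) → Finset (Finset ℕ)
  | 0, ℬ => ℬ
  | k + 1, ℬ => dComp (k + 1) (DComp k ℬ)

/-- `D_{(ℬ,k)}(B)`: the image of the set `B` obtained by following `B` through
the successive compressions `d_1, …, d_k`.  In particular `d_ℬ(B) = D_{(ℬ,n)}(B)`
for `ℬ ⊆ 𝒫(n)`. -/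
def DCompSet : ℕ → Finset (Finset ℕ) → Finset ℕ → Finset ℕ
  | 0, _, B => B
  | k + 1, ℬ, B => compressSet (DComp k ℬ) (k + 1) (DCompSet k ℬ B)

/-- The shadow `δB = {B \ {i} : i ∈ B}` of a finite set `B`. -/
def shadowSet (B : Finset ℕ) : Finset (Finset ℕ) := B.image fun i => B.erase i

/-- `B` is a bad set of `ℬ ⊆ 𝒫(n)` if `δB ⊆ ℬ` or `d_ℬ(B) = B`. -/
def BadSet (n : ℕ) (ℬ : Finset (Finset ℕ)) (B : Finset ℕ) : Prop :=
  shadowSet B ⊆ ℬ ∨ DCompSet n ℬ B = B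

/-- A family is a down-set if it is closed under taking subsets. -/
def IsDownSet (𝒟 : Finset (Finset ℕ)) : Prop := ∀ A ∈ 𝒟, ∀ B ⊆ A, B ∈ 𝒟

/-- The deficiency `def(ℬ) = Σ_{B∈ℬ} |δB \ ℬ|`. -/
def deficiency (ℬ : Finset (Finset ℕ)) : ℕ := ∑ B ∈ ℬ, (shadowSet B \ ℬ).card

/-- `𝒜 ⊆ 𝒫(n)` is a counterexample to the union-closed conjecture:
union-closed, not `{∅}`, and every element of `[n]` has degree `< |𝒜|/2`. -/
def UCCounterexample (n : ℕ) (𝒜 : Finset (Finset ℕ)) : Prop :=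
  𝒜 ⊆ (Finset.Icc 1 n).powerset ∧ UnionClosed 𝒜 ∧ 𝒜 ≠ {∅} ∧
    ∀ i ∈ Finset.Icc 1 n, ((𝒜.filter fun A => i ∈ A).card : ℚ) < (𝒜.card : ℚ) / 2

theorem mem_colexSet {k j : ℕ} : j ∈ colexSet k ↔ ∃ i, k.testBit i ∧ i + 1 = j := by
  simp only [colexSet, mem_image, mem_filter, mem_range]
  constructor
  · rintro ⟨i, ⟨-, hi⟩, rfl⟩
    exact ⟨i, hi, rfl⟩
  · rintro ⟨i, hi, rfl⟩
    exact ⟨i, ⟨(Nat.lt_two_pow_self.trans_le (Nat.ge_two_pow_of_testBit hi)).trans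
      (Nat.lt_succ_self k), hi⟩, rfl⟩

theorem succ_mem_colexSet {k i : ℕ} : i + 1 ∈ colexSet k ↔ k.testBit i := by
  simp [mem_colexSet]

theorem colexSet_injective : Function.Injective colexSet := by
  intro k l h
  refine Nat.eq_of_testBit_eq fun i => ?_
  rw [Bool.eq_iff_iff, ← succ_mem_colexSet, ← succ_mem_colexSet, h]

theorem card_colexSet_two_mul (k : ℕ) : (colexSet (2 * k)).card = (colexSet k).card := by
  have h : colexSet (2 * k) = (colexSet k).image (· + 1) := by
    ext j
    simp only [mem_colexSet, mem_image]
    constructor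
    · rintro ⟨_ | i, hi, rfl⟩
      · simp at hi
      · exact ⟨i + 1, ⟨i, by simpa [Nat.testBit_succ] using hi, rfl⟩, rfl⟩
    · rintro ⟨_, ⟨i, hi, rfl⟩, rfl⟩
      exact ⟨i + 1, by simpa [Nat.testBit_succ] using hi, rfl⟩
  rw [h, card_image_of_injective _ (add_left_injective 1)]

theorem card_colexSet_two_mul_add_one (k : ℕ) :
    (colexSet (2 * k + 1)).card = (colexSet k).card + 1 := by
  have h : colexSet (2 * k + 1) = insert 1 ((colexSet k).image (· + 1)) := by
    ext j
    simp only [mem_colexSet, mem_image, mem_insert]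
    have hk : (2 * k + 1) / 2 = k := by omega
    constructor
    · rintro ⟨_ | i, hi, rfl⟩
      · exact Or.inl rfl
      · exact Or.inr ⟨i + 1, ⟨i, by simpa [Nat.testBit_succ, hk] using hi, rfl⟩, rfl⟩
    · rintro (rfl | ⟨_, ⟨i, hi, rfl⟩, rfl⟩)
      · exact ⟨0, by simp, rfl⟩
      · exact ⟨i + 1, by simpa [Nat.testBit_succ, hk] using hi, rfl⟩
  rw [h, card_insert_of_notMem, card_image_of_injective _ (add_left_injective 1)]
  simp [mem_colexSet]

theorem totalSize_colexInit (m : ℕ) :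
    totalSize (colexInit m) = ∑ k ∈ range m, (colexSet k).card :=
  sum_image fun _ _ _ _ h => colexSet_injective h

theorem totalSize_colexInit_succ (m : ℕ) :
    totalSize (colexInit (m + 1)) = totalSize (colexInit m) + (colexSet m).card := by
  rw [totalSize_colexInit, totalSize_colexInit, sum_range_succ]

theorem totalSize_colexInit_zero : totalSize (colexInit 0) = 0 := by
  simp [totalSize_colexInit]

theorem totalSize_colexInit_two_mul (m : ℕ) :
    totalSize (colexInit (2 * m)) = 2 * totalSize (colexInit m) + m := by
  induction m with
  | zero => simp [totalSize_colexInit_zero]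
  | succ m ih =>
    rw [show 2 * (m + 1) = 2 * m + 1 + 1 by ring, totalSize_colexInit_succ,
      totalSize_colexInit_succ, totalSize_colexInit_succ, card_colexSet_two_mul,
      card_colexSet_two_mul_add_one]
    omega

theorem totalSize_colexInit_two_mul_add_one (m : ℕ) :
    totalSize (colexInit (2 * m + 1)) =
      totalSize (colexInit m) + totalSize (colexInit (m + 1)) + m := by
  rw [totalSize_colexInit_succ, totalSize_colexInit_succ, totalSize_colexInit_two_mul,
    card_colexSet_two_mul]
  omega

/-- The total size of colex initial segments is superadditive, with a gain of `min a b`. -/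
theorem totalSize_colexInit_add (a b : ℕ) :
    totalSize (colexInit a) + totalSize (colexInit b) + min a b ≤
      totalSize (colexInit (a + b)) := by
  obtain ⟨s, hs⟩ : ∃ s, a + b = s := ⟨_, rfl⟩
  induction s using Nat.strong_induction_on generalizing a b with
  | _ s ih =>
    rcases Nat.eq_zero_or_pos a with rfl | ha
    · simp [totalSize_colexInit_zero]
    rcases Nat.eq_zero_or_pos b with rfl | hb
    · simp [totalSize_colexInit_zero]
    have ih' (x y : ℕ) (hxy : x + y < a + b) := ih (x + y) (hs ▸ hxy) x y rfl
    obtain ⟨x, rfl | rfl⟩ := Nat.even_or_odd' a <;> obtain ⟨y, rfl | rfl⟩ := Nat.even_or_odd' b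
    · have h := ih' x y (by omega)
      rw [show 2 * x + 2 * y = 2 * (x + y) by ring]
      simp only [totalSize_colexInit_two_mul]
      omega
    · have h₁ := ih' x y (by omega)
      have h₂ := ih' x (y + 1) (by omega)
      rw [← add_assoc x y 1] at h₂
      rw [show 2 * x + (2 * y + 1) = 2 * (x + y) + 1 by ring]
      simp only [totalSize_colexInit_two_mul, totalSize_colexInit_two_mul_add_one]
      omega
    · have h₁ := ih' x y (by omega)
      have h₂ := ih' (x + 1) y (by omega)
      rw [add_right_comm x 1 y] at h₂
      rw [show 2 * x + 1 + 2 * y = 2 * (x + y) + 1 by ring]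
      simp only [totalSize_colexInit_two_mul, totalSize_colexInit_two_mul_add_one]
      omega
    · have h₁ := ih' x (y + 1) (by omega)
      have h₂ := ih' (x + 1) y (by omega)
      rw [add_right_comm x 1 y] at h₂
      rw [← add_assoc x y 1] at h₁
      rw [show 2 * x + 1 + (2 * y + 1) = 2 * (x + y + 1) by ring]
      simp only [totalSize_colexInit_two_mul, totalSize_colexInit_two_mul_add_one]
      omega

/-- The number of edges of the hypercube spanned by the family `F`. -/
noncomputable def edgeCount (F : Finset (Finset ℕ)) : ℕ :=
  ∑ B ∈ F, (B.filter fun j => B.erase j ∈ F).card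

theorem edgeCount_split (F : Finset (Finset ℕ)) (i : ℕ) :
    edgeCount F = edgeCount (F.filter fun B => i ∈ B) + edgeCount (F.filter fun B => i ∉ B) +
      (F.filter fun B => i ∈ B ∧ B.erase i ∈ F).card := by
  have hneg : ∑ B ∈ F with i ∉ B, (B.filter fun j => B.erase j ∈ F).card =
      edgeCount (F.filter fun B => i ∉ B) := by
    refine sum_congr rfl fun B hB => congrArg card (filter_congr fun j _ => ?_)
    have hi := (mem_filter.1 hB).2
    simp [hi]
  have hpos : ∑ B ∈ F with i ∈ B, (B.filter fun j => B.erase j ∈ F).card =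
      edgeCount (F.filter fun B => i ∈ B) + (F.filter fun B => i ∈ B ∧ B.erase i ∈ F).card := by
    rw [edgeCount, ← filter_filter, card_filter _ (F.filter _), ← sum_add_distrib]
    refine sum_congr rfl fun B hB => ?_
    have hi := (mem_filter.1 hB).2
    rw [← card_filter_add_card_filter_not (s := B.filter fun j => B.erase j ∈ F)
      (fun j => i ∈ B.erase j)]
    congr 1
    · rw [filter_filter]
      simp only [mem_filter]
    · rw [filter_filter]
      split_ifs with h
      · rw [card_eq_one]
        refine ⟨i, ?_⟩
        ext j
        simp only [mem_filter, mem_singleton, mem_erase]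
        grind
      · rw [card_eq_zero, filter_eq_empty_iff]
        intro j _
        simp only [mem_erase]
        grind
  rw [edgeCount, ← sum_filter_add_sum_filter_not F (fun B => i ∈ B), hpos, hneg]
  omega

theorem card_filter_erase_mem_le (F : Finset (Finset ℕ)) (i : ℕ) :
    (F.filter fun B => i ∈ B ∧ B.erase i ∈ F).card ≤ (F.filter fun B => i ∉ B).card := by
  refine card_le_card_of_injOn (fun B => B.erase i) ?_ ?_
  · intro B hB
    have hB' := (mem_filter.1 hB).2
    simp [hB'.2]
  · intro B hB C hC h
    have hB' := (mem_filter.1 hB).2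
    have hC' := (mem_filter.1 hC).2
    rw [← insert_erase hB'.1, ← insert_erase hC'.1]
    exact congrArg (insert i) h

/-- The edge-isoperimetric inequality in the hypercube. -/
theorem edgeCount_le_totalSize_colexInit (F : Finset (Finset ℕ)) :
    edgeCount F ≤ totalSize (colexInit F.card) := by
  induction F using Finset.strongInduction with
  | _ F ih =>
    by_cases hF : ∃ i, (∃ A ∈ F, i ∈ A) ∧ ∃ A ∈ F, i ∉ A
    · obtain ⟨i, ⟨A, hA, hiA⟩, C, hC, hiC⟩ := hF
      have h₁ := ih (F.filter fun B => i ∈ B)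
        (filter_ssubset.2 ⟨C, hC, hiC⟩)
      have h₂ := ih (F.filter fun B => i ∉ B)
        (filter_ssubset.2 ⟨A, hA, not_not.2 hiA⟩)
      have h₃ := totalSize_colexInit_add (F.filter fun B => i ∈ B).card
        (F.filter fun B => i ∉ B).card
      rw [card_filter_add_card_filter_not] at h₃
      have h₄ := card_filter_erase_mem_le F i
      have h₅ : (F.filter fun B => i ∈ B ∧ B.erase i ∈ F).card ≤
          (F.filter fun B => i ∈ B).card :=
        card_le_card (monotone_filter_right _ fun B _ h => h.1)
      have h₆ := edgeCount_split F i
      omega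
    · have h0 : edgeCount F = 0 := by
        refine sum_eq_zero fun B hB => ?_
        rw [card_eq_zero, filter_eq_empty_iff]
        exact fun j hj hBj => hF ⟨j, ⟨B, hB, hj⟩, _, hBj, notMem_erase j B⟩
      omega

theorem totalSize_eq_sum_degree {F : Finset (Finset ℕ)} {U : Finset ℕ} (hF : F ⊆ U.powerset) :
    totalSize F = ∑ j ∈ U, (F.filter fun B => j ∈ B).card := by
  have h := sum_card_bipartiteAbove_eq_sum_card_bipartiteBelow (s := F) (t := U)
    (fun B j => j ∈ B)
  rw [totalSize]
  refine Eq.trans (sum_congr rfl fun B hB => congrArg card ?_) h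
  ext j
  have := mem_powerset.1 (hF hB)
  simp only [bipartiteAbove, mem_filter]
  exact ⟨fun hj => ⟨this hj, hj⟩, fun hj => hj.2⟩

theorem two_mul_card_filter_mem_powerset {U : Finset ℕ} {j : ℕ} (hj : j ∈ U) :
    2 * (U.powerset.filter fun B => j ∈ B).card = U.powerset.card := by
  have h : (U.powerset.filter fun B => j ∈ B).card =
      (U.powerset.filter fun B => j ∉ B).card := by
    refine card_nbij' (fun B => B.erase j) (fun B => insert j B) ?_ ?_ ?_ ?_
    · intro B hB
      simp only [coe_filter, mem_powerset, Set.mem_ofPred_eq] at hB ⊢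
      exact ⟨(erase_subset _ _).trans hB.1, notMem_erase _ _⟩
    · intro B hB
      simp only [coe_filter, mem_powerset, Set.mem_ofPred_eq] at hB ⊢
      exact ⟨insert_subset hj hB.1, mem_insert_self _ _⟩
    · intro B hB
      exact insert_erase (mem_filter.1 hB).2
    · intro B hB
      exact erase_insert (mem_filter.1 hB).2
  have h' := card_filter_add_card_filter_not (s := U.powerset) (fun B => j ∈ B)
  omega

/-- In the complement of a union-closed family each set has at most one missing facet. -/
theorem card_filter_erase_notMem_le_one {𝒜 : Finset (Finset ℕ)} (h𝒜 : UnionClosed 𝒜)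
    {B : Finset ℕ} (hB : B ∉ 𝒜) : (B.filter fun j => B.erase j ∈ 𝒜).card ≤ 1 := by
  refine card_le_one.2 fun j hj k hk => ?_
  by_contra hjk
  rw [mem_filter] at hj hk
  refine hB ?_
  have hu : B.erase j ∪ B.erase k = B := by
    ext x
    simp only [mem_union, mem_erase]
    grind
  exact hu ▸ h𝒜 _ hj.2 _ hk.2

/-- The sets of `ℬ` all of whose facets lie in `ℬ` compensate the loss of at most one facet
per set. -/
theorem totalSize_add_card_le_edgeCount_add_card {U : Finset ℕ} {𝒜 : Finset (Finset ℕ)}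
    (h𝒜 : UnionClosed 𝒜) (i : ℕ) :
    totalSize (U.powerset \ 𝒜) +
        ((rootedFam (U.powerset \ 𝒜) {i}).filter fun B => B.erase i ∈ U.powerset \ 𝒜).card ≤
      edgeCount (U.powerset \ 𝒜) + (U.powerset \ 𝒜).card := by
  set ℬ := U.powerset \ 𝒜 with hℬ
  rw [rootedFam, filter_filter, card_filter, totalSize, edgeCount, ← sum_add_distrib,
    card_eq_sum_ones, ← sum_add_distrib]
  refine sum_le_sum fun B hB => ?_
  have hsplit := card_filter_add_card_filter_not (s := B) (fun j => B.erase j ∈ ℬ)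
  split_ifs with h
  · obtain ⟨⟨k, hk, hroot⟩, hi⟩ := h
    rw [mem_singleton] at hk
    subst hk
    have h0 : (B.filter fun j => B.erase j ∉ ℬ) = ∅ := by
      refine filter_eq_empty_iff.2 fun j _ => not_not.2 ?_
      rcases eq_or_ne j k with rfl | hjk
      · exact hi
      · exact hroot.2 _ (singleton_subset_iff.2 (mem_erase.2 ⟨hjk.symm, hroot.1⟩))
          (erase_subset _ _)
    rw [h0, card_empty] at hsplit
    omega
  · have hBU := mem_sdiff.1 hB
    have h1 : (B.filter fun j => B.erase j ∉ ℬ).card ≤ 1 := by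
      refine le_trans (card_le_card (monotone_filter_right _ fun j _ hj => ?_))
        (card_filter_erase_notMem_le_one h𝒜 hBU.2)
      by_contra hj'
      exact hj (mem_sdiff.2
        ⟨mem_powerset.2 ((erase_subset _ _).trans (mem_powerset.1 hBU.1)), hj'⟩)
    omega

/-- Every element of the ground set lies in more than half of the sets of the complement of a
counterexample. -/
theorem UCCounterexample.card_lt_two_mul_card_filter {n : ℕ} {𝒜 : Finset (Finset ℕ)}
    (h : UCCounterexample n 𝒜) {j : ℕ} (hj : j ∈ Icc 1 n) :
    ((Icc 1 n).powerset \ 𝒜).card <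
      2 * (((Icc 1 n).powerset \ 𝒜).filter fun B => j ∈ B).card := by
  have h₁ := two_mul_card_filter_mem_powerset hj
  have h₂ := card_sdiff_add_card_eq_card h.1
  have h₃ : (((Icc 1 n).powerset \ 𝒜).filter fun B => j ∈ B).card +
      (𝒜.filter fun B => j ∈ B).card = ((Icc 1 n).powerset.filter fun B => j ∈ B).card := by
    rw [← card_sdiff_add_card_eq_card (filter_subset_filter _ h.1)]
    congr 2
    ext B
    simp only [mem_filter, mem_sdiff]
    tauto
  have h₄ : 2 * (𝒜.filter fun B => j ∈ B).card < 𝒜.card := by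
    have := h.2.2.2 j hj
    rw [lt_div_iff₀ two_pos] at this
    rw [mul_comm]
    exact_mod_cast this
  omega

/-- Suppose `𝒜 ⊆ 𝒫(n)` is a counterexample to the
union-closed conjecture, `ℬ = 𝒫(n) \ 𝒜` with `|ℬ| = m`, and `p ∈ [0,1]`. If
`|ℬ_{{i}}| ≥ 3p·m` for some `i ∈ [n]`, then `‖I(m)‖ > m(n/2 - 1 + p)`. -/
theorem stmt18 (n : ℕ) (𝒜 ℬ : Finset (Finset ℕ)) (h : UCCounterexample n 𝒜)
    (hB : ℬ = (Finset.Icc 1 n).powerset \ 𝒜) (m : ℕ) (hm : m = ℬ.card)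
    (p : ℝ) (hp : p ∈ Set.Icc (0 : ℝ) 1)
    (hroot : ∃ i ∈ Finset.Icc 1 n, 3 * p * m ≤ ((rootedFam ℬ {i}).card : ℝ)) :
    (m : ℝ) * ((n : ℝ) / 2 - 1 + p) < (totalSize (colexInit m) : ℝ) := by
  obtain ⟨i, hi, hroot⟩ := hroot
  subst hB
  have hlt := h.card_lt_two_mul_card_filter hi
  have hedge := totalSize_add_card_le_edgeCount_add_card (U := Icc 1 n) h.2.1 i
  have hdeg : (n - 1) * m + 2 * (((Icc 1 n).powerset \ 𝒜).filter fun B => i ∈ B).card ≤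
      2 * totalSize ((Icc 1 n).powerset \ 𝒜) := by
    have hsum : (n - 1) * m ≤ ∑ j ∈ (Icc 1 n).erase i,
        2 * (((Icc 1 n).powerset \ 𝒜).filter fun B => j ∈ B).card := by
      have h' := card_nsmul_le_sum ((Icc 1 n).erase i)
        (fun j => 2 * (((Icc 1 n).powerset \ 𝒜).filter fun B => j ∈ B).card) m fun j hj =>
          hm ▸ (h.card_lt_two_mul_card_filter (mem_of_mem_erase hj)).le
      rwa [card_erase_of_mem hi, Nat.card_Icc, Nat.add_sub_cancel, smul_eq_mul] at h'
    rw [totalSize_eq_sum_degree sdiff_subset, mul_sum, ← sum_erase_add _ _ hi]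
    omega
  set ℬ := (Icc 1 n).powerset \ 𝒜 with hℬ
  have hsplit := edgeCount_split ℬ i
  have hcard := card_filter_add_card_filter_not (s := ℬ) (fun B => i ∈ B)
  have hrcard := card_filter_add_card_filter_not (s := rootedFam ℬ {i})
    (fun B => B.erase i ∈ ℬ)
  have hunrooted : (ℬ.filter fun B => i ∈ B ∧ B.erase i ∈ ℬ).card +
      ((rootedFam ℬ {i}).filter fun B => B.erase i ∉ ℬ).card ≤
        (ℬ.filter fun B => i ∈ B).card := by
    rw [← card_union_of_disjoint]
    · refine card_le_card fun B hB => ?_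
      simp only [rootedFam, mem_union, mem_filter, mem_singleton, exists_eq_left] at hB ⊢
      rcases hB with hB | hB
      · exact ⟨hB.1, hB.2.1⟩
      · exact ⟨hB.1.1, hB.1.2.1⟩
    · exact disjoint_left.2 fun B hB hB' => (mem_filter.1 hB').2 (mem_filter.1 hB).2.2
  have hiso := edgeCount_le_totalSize_colexInit ℬ
  have hiso_mem := edgeCount_le_totalSize_colexInit (ℬ.filter fun B => i ∈ B)
  have hiso_notMem := edgeCount_le_totalSize_colexInit (ℬ.filter fun B => i ∉ B)
  have hadd := totalSize_colexInit_add (ℬ.filter fun B => i ∈ B).card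
    (ℬ.filter fun B => i ∉ B).card
  rw [hcard] at hadd
  rw [← hm] at hlt hedge hcard hiso hadd
  have hn : (n - 1) * m + m = n * m := by
    rw [← Nat.succ_mul, Nat.succ_eq_add_one, Nat.sub_add_cancel
      ((mem_Icc.1 hi).1.trans (mem_Icc.1 hi).2)]
  have hstrict : n * m < 2 * totalSize (colexInit m) + 2 * m := by omega
  have hroots : n * m + (rootedFam ℬ {i}).card ≤ 2 * totalSize (colexInit m) + 2 * m := by
    omega
  have hstrict' : (n : ℝ) * m < 2 * totalSize (colexInit m) + 2 * m := by exact_mod_cast hstrict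
  have hroots' : (n : ℝ) * m + (rootedFam ℬ {i}).card ≤
      2 * totalSize (colexInit m) + 2 * m := by exact_mod_cast hroots
  linarith
end

section
/- Let r and m be positive integers with r ≥ 1 and 2^r/3 ≤ m ≤ 2^{r+1}/3, and write m' = m − 2^r/3 (a rational number). Then ‖I(m)‖ ≤ m(r/2 − 1) + 3m'/2. -/
open Finset
open scoped Classical

lemma card_colexSet (k : ℕ) : (colexSet k).card = k.bitIndices.length := by
  have h : (Finset.range (k + 1)).filter (fun i => k.testBit i) = k.bitIndices.toFinset := by
    ext i
    simp only [Finset.mem_filter, Finset.mem_range, List.mem_toFinset, Nat.mem_bitIndices,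
      and_iff_right_iff_imp]
    intro hi
    have := Nat.ge_two_pow_of_testBit hi
    have := i.lt_two_pow_self
    omega
  rw [colexSet, Finset.card_image_of_injective _ (add_left_injective 1), h,
    List.toFinset_card_of_nodup Nat.bitIndices_nodup]

/-- The total number of binary ones in the numbers `0, …, m - 1`. -/
def bitSum (m : ℕ) : ℕ := ∑ k ∈ Finset.range m, k.bitIndices.length

lemma bitSum_succ (m : ℕ) : bitSum (m + 1) = bitSum m + m.bitIndices.length :=
  Finset.sum_range_succ _ _

lemma bitSum_two_mul (m : ℕ) : bitSum (2 * m) = 2 * bitSum m + m := by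
  induction m with
  | zero => simp [bitSum]
  | succ m ih =>
    rw [show 2 * (m + 1) = 2 * m + 1 + 1 by ring, bitSum_succ, bitSum_succ, bitSum_succ, ih,
      Nat.bitIndices_two_mul, Nat.bitIndices_two_mul_add_one]
    simp only [List.length_cons, List.length_map]
    omega

lemma bitSum_two_mul_add_one (m : ℕ) :
    bitSum (2 * m + 1) = bitSum m + bitSum (m + 1) + m := by
  rw [bitSum_succ, bitSum_two_mul, bitSum_succ, Nat.bitIndices_two_mul, List.length_map]
  omega

/-- The truncated subtraction is the positive part of `2 ^ r - 3 * m`. -/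
lemma two_mul_bitSum_add_le {r m : ℕ} (hm : m ≤ 2 ^ r) :
    2 * bitSum m + 2 ^ r ≤ m * (r + 1) + (2 ^ r - 3 * m) := by
  induction r generalizing m with
  | zero =>
    have : m = 0 ∨ m = 1 := by simp at hm; omega
    rcases this with rfl | rfl <;> simp [bitSum]
  | succ r ih =>
    rw [pow_succ] at hm ⊢
    obtain ⟨n, rfl | rfl⟩ := m.even_or_odd'
    · have h := ih (m := n) (by omega)
      rw [bitSum_two_mul, show 2 * n * (r + 1 + 1) = 2 * (n * (r + 1)) + 2 * n by ring]
      omega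
    · have h := ih (m := n) (by omega)
      have h' := ih (m := n + 1) (by omega)
      rw [add_mul n 1] at h'
      rw [bitSum_two_mul_add_one,
        show (2 * n + 1) * (r + 1 + 1) = 2 * (n * (r + 1)) + (r + 1) + 2 * n + 1 by ring]
      omega

lemma totalSize_colexInit_le (m : ℕ) : totalSize (colexInit m) ≤ bitSum m :=
  (Finset.sum_image_le_of_nonneg fun _ _ => Nat.zero_le _).trans_eq
    (Finset.sum_congr rfl fun k _ => card_colexSet k)

/-- Let `r, m` be positive integers with
`2^r/3 ≤ m ≤ 2^{r+1}/3`, and write `m' = m - 2^r/3`. Then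
`‖I(m)‖ ≤ m(r/2 - 1) + 3m'/2`. -/
theorem stmt19 (r m : ℕ) (hr : 1 ≤ r) (hm : 1 ≤ m)
    (h₁ : (2 ^ r : ℚ) / 3 ≤ (m : ℚ)) (h₂ : (m : ℚ) ≤ (2 ^ (r + 1) : ℚ) / 3)
    (m' : ℚ) (hm' : m' = (m : ℚ) - (2 ^ r : ℚ) / 3) :
    (totalSize (colexInit m) : ℚ) ≤ (m : ℚ) * ((r : ℚ) / 2 - 1) + 3 * m' / 2 := by
  have hlow : 2 ^ r ≤ 3 * m := by
    have : (2 ^ r : ℚ) ≤ 3 * m := by linarith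
    exact_mod_cast this
  have hup : m ≤ 2 ^ r := by
    have : (m : ℚ) ≤ 2 ^ r := by
      rw [pow_succ] at h₂
      linarith [show (0 : ℚ) < 2 ^ r by positivity]
    exact_mod_cast this
  have hbit : 2 * totalSize (colexInit m) + 2 ^ r ≤ m * (r + 1) := by
    have := two_mul_bitSum_add_le hup
    have := totalSize_colexInit_le m
    omega
  have hbit' : 2 * (totalSize (colexInit m) : ℚ) + 2 ^ r ≤ m * (r + 1) := by
    exact_mod_cast hbit
  subst hm'
  linarith
end
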